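/- If the configuration (s,m,n) is transformed into the configuration (t,k,l) by a single application of one instruction of the Minsky machine 𝓜, then Int + Ax(𝓜) ⊢ E_{t,k,l} → E_{s,m,n}. -/

import Mathlib

namespace Paper

/-- Propositional formulas over variables indexed by ℕ, with ⊥, ∧, ∨, →. -/
inductive Fml : Type
  | var : ℕ → Fml
  | bot : Fml
  | and : Fml → Fml → Fml
  | or : Fml → Fml → Fml
  | imp : Fml → Fml → Fml

namespace Fml

/-- ¬A := A → ⊥ -/
def neg (A : Fml) : Fml := A.imp bot

/-- A ↔ B := (A → B) ∧ (B → A) -/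
def biimp (A B : Fml) : Fml := (A.imp B).and (B.imp A)

/-- The three fixed distinct variables p, q, r. -/
def p : Fml := var 0
def q : Fml := var 1
def r : Fml := var 2

/-- Applying a substitution σ to a formula. -/
def subst (σ : ℕ → Fml) : Fml → Fml
  | var n => σ n
  | bot => bot
  | and A B => and (subst σ A) (subst σ B)
  | or A B => or (subst σ A) (subst σ B)
  | imp A B => imp (subst σ A) (subst σ B)

/-- The set of variables occurring in a formula. -/
def vars : Fml → Finset ℕ
  | var n => {n}
  | bot => ∅
  | and A B => A.vars ∪ B.vars
  | or A B => A.vars ∪ B.vars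
  | imp A B => A.vars ∪ B.vars

/-- An injective encoding of formulas into ℕ. -/
def encode : Fml → ℕ
  | var n => 5 * n
  | bot => 1
  | and A B => 5 * Nat.pair A.encode B.encode + 2
  | or A B => 5 * Nat.pair A.encode B.encode + 3
  | imp A B => 5 * Nat.pair A.encode B.encode + 4

end Fml

open Fml

/-- The standard axioms of the intuitionistic propositional calculus Int. -/
def IntAx : Set Fml :=
  { p.imp (q.imp p),
    (p.imp (q.imp r)).imp ((p.imp q).imp (p.imp r)),
    (p.and q).imp p,
    (p.and q).imp q,
    p.imp (q.imp (p.and q)),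
    p.imp (p.or q),
    q.imp (p.or q),
    (p.imp r).imp ((q.imp r).imp ((p.or q).imp r)),
    (p.imp q).imp ((p.imp q.neg).imp p.neg),
    p.imp (p.neg.imp q) }

/-- Derivability in Int extended with the extra axioms Γ, with rules
    modus ponens and substitution.  `Deriv ∅ A` is `Int ⊢ A`;
    `Deriv {B} A` is `Int + B ⊢ A`. -/
inductive Deriv (Γ : Set Fml) : Fml → Prop
  | ax {A : Fml} : A ∈ IntAx → Deriv Γ A
  | extra {A : Fml} : A ∈ Γ → Deriv Γ A
  | mp {A B : Fml} : Deriv Γ (A.imp B) → Deriv Γ A → Deriv Γ B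
  | subst {A : Fml} (σ : ℕ → Fml) : Deriv Γ A → Deriv Γ (A.subst σ)

/-- (S,T) pair: `ST x n = (S_{n-2}[x], T_{n-2}[x])` (index shifted by 2). -/
def ST (x : Fml) : ℕ → Fml × Fml
  | 0 => (x.neg, x.neg.neg)
  | 1 =>
      let s := Fml.imp x.neg.neg x
      (s, s.imp (Fml.or x.neg x.neg.neg))
  | (n+2) =>
      let st1 := ST x (n+1)
      let st0 := ST x n
      let s := st1.2.imp (st1.1.or st0.2)
      (s, s.imp (st1.1.or st1.2))

def Sf (x : Fml) (n : ℕ) : Fml := (ST x n).1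
def Tf (x : Fml) (n : ℕ) : Fml := (ST x n).2

/-- `A0 n = A_{n-5}^0 = S_{n-2}[r]`, `B0 n = B_{n-5}^0` (index shifted by 5). -/
def A0 (n : ℕ) : Fml := Sf r n
def B0 (n : ℕ) : Fml := Tf r n

def C1 : Fml := A0 5
def C2 : Fml := B0 5

/-- Generic groups (A^1),(B^1) / (A^2),(B^2): `AB v c1 c2 n = (A_{n-5}, B_{n-5})`
    built over the variable `v` (index shifted by 5). -/
def AB (v c1 c2 : Fml) : ℕ → Fml × Fml
  | 0 => (Sf v 0, Tf v 0)
  | 1 => (Sf v 1, Tf v 1)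
  | 2 => (Sf v 2, Tf v 2)
  | 3 =>
      let x2 := AB v c1 c2 2
      let x1 := AB v c1 c2 1
      (x2.2.imp (x2.1.or x1.2), x2.1.imp (c1.or x2.2))
  | 4 =>
      let x3 := AB v c1 c2 3
      let x2 := AB v c1 c2 2
      (x3.2.imp (x3.1.or x2.2), x3.1.imp (x2.1.or x3.2))
  | (n+5) =>
      let x1 := AB v c1 c2 (n+4)
      let x0 := AB v c1 c2 (n+3)
      ((c2.and x1.2).imp (c1.or (x1.1.or x0.2)),
       (c2.and x1.1).imp (c1.or (x0.1.or x1.2)))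

/-- `A1 n = A_{n-5}^1` etc. (index shifted by 5). -/
def A1 (n : ℕ) : Fml := (AB p C1 C2 n).1
def B1 (n : ℕ) : Fml := (AB p C1 C2 n).2
def A2 (n : ℕ) : Fml := (AB q C2 C1 n).1
def B2 (n : ℕ) : Fml := (AB q C2 C1 n).2

/-- `AF j` is the family A^j, `BF j` the family B^j (ℕ-index shifted by 5). -/
def AF : Fin 3 → ℕ → Fml := ![A0, A1, A2]
def BF : Fin 3 → ℕ → Fml := ![B0, B1, B2]

/-- The code E_{s,m,n} of a configuration (s,m,n). -/
def Efml (s m n : ℕ) : Fml :=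
  ((A0 (3*s+7)).and ((B0 (3*s+7)).and ((A1 (m+6)).and ((B1 (m+6)).and
      ((A2 (n+6)).and (B2 (n+6))))))).imp
  ((A0 (3*s+6)).or ((B0 (3*s+6)).or ((A1 (m+5)).or ((B1 (m+5)).or
      ((A2 (n+5)).or (B2 (n+5)))))))

/-- `FG x y k = (F_k[p,q,x,y], G_k[p,q,x,y])`. -/
def FG (x y : Fml) : ℕ → Fml × Fml
  | 0 => (p, q)
  | 1 => ((y.and q).imp (x.or p), (y.and p).imp (x.or q))
  | (k+2) =>
      let fg1 := FG x y (k+1)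
      let fg0 := FG x y k
      ((y.and fg1.2).imp (x.or (fg1.1.or fg0.2)),
       (y.and fg1.1).imp (x.or (fg1.2.or fg0.1)))

/-- Key formulas F_k^1, G_k^1, F_k^2, G_k^2 (as formulas in p,q,r). -/
def F1k (k : ℕ) : Fml := (FG C1 C2 k).1
def G1k (k : ℕ) : Fml := (FG C1 C2 k).2
def F2k (k : ℕ) : Fml := (FG C2 C1 k).1
def G2k (k : ℕ) : Fml := (FG C2 C1 k).2

/-- Substituting X for p and Y for q. -/
def sub2 (X Y : Fml) (A : Fml) : Fml :=
  A.subst (fun n => if n = 0 then X else if n = 1 then Y else var n)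

/-- `Pf a b = P_{a-1,b-1}` (indices shifted by 1, so defined for all a,b:ℕ, i.e. i,j ≥ -1). -/
def Pf (a b : ℕ) : Fml :=
  (C2.imp (C1.or ((A1 (a+4)).or (B1 (a+3))))).and
  (C1.imp (C2.or ((A2 (b+4)).or (B2 (b+3)))))

/-- `Qf a b = Q_{a-1,b-1}` (indices shifted by 1). -/
def Qf (a b : ℕ) : Fml :=
  (C2.imp (C1.or ((A1 (a+3)).or (B1 (a+4))))).and
  (C1.imp (C2.or ((A2 (b+3)).or (B2 (b+4)))))

/-- Ê_{s,i,j} (intended for i,j ≥ 1). -/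
def Ehat (s i j : ℕ) : Fml :=
  ((A0 (3*s+7)).and ((B0 (3*s+7)).and ((F1k (i+1)).and ((G1k (i+1)).and
      ((F2k (j+1)).and (G2k (j+1))))))).imp
  ((A0 (3*s+6)).or ((B0 (3*s+6)).or ((F1k i).or ((G1k i).or
      ((F2k j).or (G2k j))))))

/-- Ê_{s,0,*}. -/
def Ehat0star (s : ℕ) : Fml :=
  ((A0 (3*s+7)).and ((B0 (3*s+7)).and ((A1 6).and (B1 6)))).imp
  ((A0 (3*s+6)).or ((B0 (3*s+6)).or ((A1 5).or ((B1 5).or q))))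

/-- Ê_{s,*,0}. -/
def Ehatstar0 (s : ℕ) : Fml :=
  ((A0 (3*s+7)).and ((B0 (3*s+7)).and ((A2 6).and (B2 6)))).imp
  ((A0 (3*s+6)).or ((B0 (3*s+6)).or (p.or ((A2 5).or (B2 5)))))

/-! ### Minsky machines -/

/-- Configurations (s, m, n). -/
abbrev Cfg := ℕ × ℕ × ℕ

/-- The four forms of Minsky machine instructions. -/
inductive MInstr : Type
  | inc1 (s t : ℕ)                -- s ↦ (t,1,0)
  | inc2 (s t : ℕ)                -- s ↦ (t,0,1)
  | dec1 (s t u : ℕ)              -- s ↦ (t,-1,0)/(u,0,0)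
  | dec2 (s t u : ℕ)              -- s ↦ (t,0,-1)/(u,0,0)
deriving DecidableEq

def MInstr.state : MInstr → ℕ
  | inc1 s _ => s
  | inc2 s _ => s
  | dec1 s _ _ => s
  | dec2 s _ _ => s

/-- One application of an instruction to a configuration. -/
def MInstr.step : MInstr → Cfg → Cfg → Prop
  | inc1 s t, c, c' => ∃ m n, c = (s, m, n) ∧ c' = (t, m + 1, n)
  | inc2 s t, c, c' => ∃ m n, c = (s, m, n) ∧ c' = (t, m, n + 1)
  | dec1 s t u, c, c' => ∃ m n, c = (s, m, n) ∧
      ((0 < m ∧ c' = (t, m - 1, n)) ∨ (m = 0 ∧ c' = (u, 0, n)))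
  | dec2 s t u, c, c' => ∃ m n, c = (s, m, n) ∧
      ((0 < n ∧ c' = (t, m, n - 1)) ∨ (n = 0 ∧ c' = (u, m, 0)))

/-- A Minsky machine: a finite deterministic set of instructions. -/
structure Minsky where
  instrs : List MInstr
  det : ∀ I ∈ instrs, ∀ J ∈ instrs, I.state = J.state → I = J

/-- One step of the machine. -/
def Minsky.Step (M : Minsky) (c c' : Cfg) : Prop := ∃ I ∈ M.instrs, I.step c c'

/-- (s,m,n) ⟹_𝓜 (t,k,l): reachability in finitely many (possibly zero) steps. -/
def Minsky.Reach (M : Minsky) : Cfg → Cfg → Prop := Relation.ReflTransGen M.Step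

/-- The formula Ax(I) simulating an instruction I. -/
def AxI : MInstr → Fml
  | .inc1 s t => (Ehat t 2 1).imp (Ehat s 1 1)
  | .inc2 s t => (Ehat t 1 2).imp (Ehat s 1 1)
  | .dec1 s t u => ((Ehat t 1 1).imp (Ehat s 2 1)).and ((Ehat0star u).imp (Ehat0star s))
  | .dec2 s t u => ((Ehat t 1 1).imp (Ehat s 1 2)).and ((Ehatstar0 u).imp (Ehatstar0 s))

/-- The formula Ax(𝓜): the conjunction of Ax(I) over all instructions of 𝓜. -/
def AxM (M : Minsky) : Fml := M.instrs.foldr (fun I acc => (AxI I).and acc) Fml.bot.neg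

/-! ### Kripke semantics and the frame 𝔉 -/

/-- Intuitionistic forcing over an arbitrary accessibility relation R and valuation V. -/
def Force {α : Type} (R : α → α → Prop) (V : ℕ → α → Prop) : α → Fml → Prop
  | w, Fml.var n => V n w
  | _, Fml.bot => False
  | w, Fml.and A B => Force R V w A ∧ Force R V w B
  | w, Fml.or A B => Force R V w A ∨ Force R V w B
  | w, Fml.imp A B => ∀ w', R w w' → Force R V w' A → Force R V w' B

/-- A valuation is R-upward-closed. -/
def UpClosed {α : Type} (R : α → α → Prop) (V : ℕ → α → Prop) : Prop :=
  ∀ n w w', V n w → R w w' → V n w'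

/-- The equivalence ∼_𝓜: mutual reachability. -/
def MEquiv (M : Minsky) : Setoid Cfg where
  r c c' := M.Reach c c' ∧ M.Reach c' c
  iseqv := ⟨fun _ => ⟨Relation.ReflTransGen.refl, Relation.ReflTransGen.refl⟩,
    fun h => ⟨h.2, h.1⟩, fun h h' => ⟨h.1.trans h'.1, h'.2.trans h.2⟩⟩

/-- Equivalence classes of configurations. -/
def Cl (M : Minsky) := Quotient (MEquiv M)

/-- The class [c] of a configuration c. -/
def cl (M : Minsky) (c : Cfg) : Cl M := Quotient.mk (MEquiv M) c

/-- ⟹_𝓜 lifted to equivalence classes. -/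
def ClReach (M : Minsky) (α β : Cl M) : Prop :=
  ∃ c c', cl M c = α ∧ cl M c' = β ∧ M.Reach c c'

/-- Raw points: a_i^j, b_i^j (ℕ-index n = i+5, so i ≥ -5) and e_α. -/
inductive Pt (M : Minsky) : Type
  | a (j : Fin 3) (n : ℕ)
  | b (j : Fin 3) (n : ℕ)
  | e (α : Cl M)

/-- The immediate-accessibility relation R' of the frame 𝔉 (on raw points). -/
inductive Edge (M : Minsky) (c0 : Cfg) : Pt M → Pt M → Prop
  | a4a5 (j : Fin 3) : Edge M c0 (.a j 1) (.a j 0)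
  | b4a5 (j : Fin 3) : Edge M c0 (.b j 1) (.a j 0)
  | b4b5 (j : Fin 3) : Edge M c0 (.b j 1) (.b j 0)
  | a3a4 (j : Fin 3) : Edge M c0 (.a j 2) (.a j 1)
  | a3b5 (j : Fin 3) : Edge M c0 (.a j 2) (.b j 0)
  | b3a4 (j : Fin 3) : Edge M c0 (.b j 2) (.a j 1)
  | b3b4 (j : Fin 3) : Edge M c0 (.b j 2) (.b j 1)
  -- group j = 0, i ≥ -2:
  | a0a (n : ℕ) : Edge M c0 (.a 0 (n+3)) (.a 0 (n+2))
  | a0b (n : ℕ) : Edge M c0 (.a 0 (n+3)) (.b 0 (n+1))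
  | b0a (n : ℕ) : Edge M c0 (.b 0 (n+3)) (.a 0 (n+2))
  | b0b (n : ℕ) : Edge M c0 (.b 0 (n+3)) (.b 0 (n+2))
  -- groups j = 1,2 at i = -2:
  | am2a (j : Fin 3) (h : j ≠ 0) : Edge M c0 (.a j 3) (.a j 2)
  | am2b (j : Fin 3) (h : j ≠ 0) : Edge M c0 (.a j 3) (.b j 1)
  | bm2each1 : Edge M c0 (.b 1 3) (.a 0 5)
  | bm2b1 : Edge M c0 (.b 1 3) (.b 1 2)
  | bm2each2 : Edge M c0 (.b 2 3) (.b 0 5)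
  | bm2b2 : Edge M c0 (.b 2 3) (.b 2 2)
  -- groups j = 1,2, i ≥ -1:
  | aja (j : Fin 3) (h : j ≠ 0) (n : ℕ) : Edge M c0 (.a j (n+4)) (.a j (n+3))
  | ajb (j : Fin 3) (h : j ≠ 0) (n : ℕ) : Edge M c0 (.a j (n+4)) (.b j (n+2))
  | bja (j : Fin 3) (h : j ≠ 0) (n : ℕ) : Edge M c0 (.b j (n+4)) (.a j (n+2))
  | bjb (j : Fin 3) (h : j ≠ 0) (n : ℕ) : Edge M c0 (.b j (n+4)) (.b j (n+3))
  -- group R_{s,m,n}: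
  | e1 (s m n : ℕ) (h : M.Reach c0 (s,m,n)) : Edge M c0 (.e (cl M (s,m,n))) (.a 0 (3*s+6))
  | e2 (s m n : ℕ) (h : M.Reach c0 (s,m,n)) : Edge M c0 (.e (cl M (s,m,n))) (.b 0 (3*s+6))
  | e3 (s m n : ℕ) (h : M.Reach c0 (s,m,n)) : Edge M c0 (.e (cl M (s,m,n))) (.a 1 (m+5))
  | e4 (s m n : ℕ) (h : M.Reach c0 (s,m,n)) : Edge M c0 (.e (cl M (s,m,n))) (.b 1 (m+5))
  | e5 (s m n : ℕ) (h : M.Reach c0 (s,m,n)) : Edge M c0 (.e (cl M (s,m,n))) (.a 2 (n+5))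
  | e6 (s m n : ℕ) (h : M.Reach c0 (s,m,n)) : Edge M c0 (.e (cl M (s,m,n))) (.b 2 (n+5))
  -- (e_α, e_β) whenever α ⟹ β:
  | ee (c c' : Cfg) (h : M.Reach c c') : Edge M c0 (.e (cl M c)) (.e (cl M c'))

/-- Which raw points belong to the set of worlds W. -/
def Valid (M : Minsky) (c0 : Cfg) : Pt M → Prop
  | .e α => ClReach M (cl M c0) α
  | _ => True

/-- The set of worlds W of the frame 𝔉. -/
def W (M : Minsky) (c0 : Cfg) := {x : Pt M // Valid M c0 x}

/-- The accessibility relation R of 𝔉: reflexive-transitive closure of R'. -/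
def Rel (M : Minsky) (c0 : Cfg) : W M c0 → W M c0 → Prop :=
  Relation.ReflTransGen (fun x y => Edge M c0 x.1 y.1)

/-- The point a_{n-5}^j of W. -/
def aPt (M : Minsky) (c0 : Cfg) (j : Fin 3) (n : ℕ) : W M c0 := ⟨.a j n, trivial⟩

/-- The point b_{n-5}^j of W. -/
def bPt (M : Minsky) (c0 : Cfg) (j : Fin 3) (n : ℕ) : W M c0 := ⟨.b j n, trivial⟩

/-- The point e_{[c]} of W (for a reachable configuration c). -/
def ePt (M : Minsky) (c0 : Cfg) (c : Cfg) (h : M.Reach c0 c) : W M c0 :=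
  ⟨.e (cl M c), ⟨c0, c, rfl, rfl, h⟩⟩

/-- The valuation 𝔙 of the model 𝔐 (p = var 0 ↔ group 1, q = var 1 ↔ group 2,
    r = var 2 ↔ group 0). -/
def V0 (M : Minsky) (c0 : Cfg) : ℕ → W M c0 → Prop
  | 0, w => ¬ (Rel M c0 w (aPt M c0 1 1) ∨ Rel M c0 w (bPt M c0 1 0))
  | 1, w => ¬ (Rel M c0 w (aPt M c0 2 1) ∨ Rel M c0 w (bPt M c0 2 0))
  | 2, w => ¬ (Rel M c0 w (aPt M c0 0 1) ∨ Rel M c0 w (bPt M c0 0 0))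
  | _, _ => True

end Paper

namespace Paper

open Fml

section Derivations

variable {Γ : Set Fml} {A B C : Fml}

/-- The substitution sending `p`, `q`, `r` to `A`, `B`, `C`. -/
def instPQR (A B C : Fml) : ℕ → Fml
  | 0 => A
  | 1 => B
  | 2 => C
  | n => var n

theorem Deriv.imp_const (A B : Fml) : Deriv Γ (A.imp (B.imp A)) :=
  .subst (instPQR A B B) (.ax (A := p.imp (q.imp p)) (by simp [IntAx]))

theorem Deriv.imp_distrib (A B C : Fml) :
    Deriv Γ ((A.imp (B.imp C)).imp ((A.imp B).imp (A.imp C))) :=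
  .subst (instPQR A B C)
    (.ax (A := (p.imp (q.imp r)).imp ((p.imp q).imp (p.imp r))) (by simp [IntAx]))

theorem Deriv.and_left (A B : Fml) : Deriv Γ ((A.and B).imp A) :=
  .subst (instPQR A B B) (.ax (A := (p.and q).imp p) (by simp [IntAx]))

theorem Deriv.and_right (A B : Fml) : Deriv Γ ((A.and B).imp B) :=
  .subst (instPQR A B B) (.ax (A := (p.and q).imp q) (by simp [IntAx]))

theorem Deriv.and_intro (A B : Fml) : Deriv Γ (A.imp (B.imp (A.and B))) :=
  .subst (instPQR A B B) (.ax (A := p.imp (q.imp (p.and q))) (by simp [IntAx]))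

theorem Deriv.or_left (A B : Fml) : Deriv Γ (A.imp (A.or B)) :=
  .subst (instPQR A B B) (.ax (A := p.imp (p.or q)) (by simp [IntAx]))

theorem Deriv.or_right (A B : Fml) : Deriv Γ (B.imp (A.or B)) :=
  .subst (instPQR A B B) (.ax (A := q.imp (p.or q)) (by simp [IntAx]))

theorem Deriv.or_elim (A B C : Fml) :
    Deriv Γ ((A.imp C).imp ((B.imp C).imp ((A.or B).imp C))) :=
  .subst (instPQR A B C)
    (.ax (A := (p.imp r).imp ((q.imp r).imp ((p.or q).imp r))) (by simp [IntAx]))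

theorem Deriv.imp_neg_imp (A B : Fml) : Deriv Γ (A.imp (A.neg.imp B)) :=
  .subst (instPQR A B B) (.ax (A := p.imp (p.neg.imp q)) (by simp [IntAx]))

theorem Deriv.weaken (A : Fml) (h : Deriv Γ B) : Deriv Γ (A.imp B) :=
  .mp (.imp_const B A) h

/-- Modus ponens under a common hypothesis. -/
theorem Deriv.mp_under (h : Deriv Γ (A.imp (B.imp C))) (h' : Deriv Γ (A.imp B)) :
    Deriv Γ (A.imp C) :=
  .mp (.mp (.imp_distrib A B C) h) h'

theorem Deriv.imp_refl (A : Fml) : Deriv Γ (A.imp A) :=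
  .mp_under (.imp_const A (A.imp A)) (.imp_const A A)

theorem Deriv.imp_trans (h : Deriv Γ (A.imp B)) (h' : Deriv Γ (B.imp C)) :
    Deriv Γ (A.imp C) :=
  .mp_under (.weaken A h') h

theorem Deriv.imp_and (h : Deriv Γ (A.imp B)) (h' : Deriv Γ (A.imp C)) :
    Deriv Γ (A.imp (B.and C)) :=
  .mp_under (h.imp_trans (.and_intro B C)) h'

theorem Deriv.or_imp (h : Deriv Γ (A.imp C)) (h' : Deriv Γ (B.imp C)) :
    Deriv Γ ((A.or B).imp C) :=
  .mp (.mp (.or_elim A B C) h) h'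

theorem Deriv.curry (h : Deriv Γ ((A.and B).imp C)) : Deriv Γ (A.imp (B.imp C)) :=
  (Deriv.and_intro A B).imp_trans (.mp (.imp_distrib B (A.and B) C) (.weaken B h))

theorem Deriv.uncurry (h : Deriv Γ (A.imp (B.imp C))) : Deriv Γ ((A.and B).imp C) :=
  .mp_under ((Deriv.and_left A B).imp_trans h) (.and_right A B)

theorem Deriv.bot_imp (A : Fml) : Deriv Γ (bot.imp A) :=
  .mp_under (.imp_neg_imp bot A) (.weaken bot (.imp_refl bot))

end Derivations

section Semantics

/-- The value of a formula in a Heyting algebra. -/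
def eval {H : Type*} [HeytingAlgebra H] (v : ℕ → H) : Fml → H
  | .var n => v n
  | .bot => ⊥
  | .and A B => eval v A ⊓ eval v B
  | .or A B => eval v A ⊔ eval v B
  | .imp A B => eval v A ⇨ eval v B

/-- Formulas modulo provable equivalence over `Γ`. -/
def lindenbaumSetoid (Γ : Set Fml) : Setoid Fml where
  r A B := Deriv Γ (A.imp B) ∧ Deriv Γ (B.imp A)
  iseqv := ⟨fun A => ⟨.imp_refl A, .imp_refl A⟩, fun h => ⟨h.2, h.1⟩,
    fun h h' => ⟨h.1.imp_trans h'.1, h'.2.imp_trans h.2⟩⟩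

/-- The Lindenbaum algebra of `Int + Γ`. -/
def Lindenbaum (Γ : Set Fml) : Type := Quotient (lindenbaumSetoid Γ)

namespace Lindenbaum

variable {Γ : Set Fml}

/-- The class of a formula. -/
def mk (Γ : Set Fml) (A : Fml) : Lindenbaum Γ := Quotient.mk (lindenbaumSetoid Γ) A

theorem and_mono {A A' B B' : Fml} (h : Deriv Γ (A.imp A')) (h' : Deriv Γ (B.imp B')) :
    Deriv Γ ((A.and B).imp (A'.and B')) :=
  .imp_and ((Deriv.and_left A B).imp_trans h) ((Deriv.and_right A B).imp_trans h')

theorem or_mono {A A' B B' : Fml} (h : Deriv Γ (A.imp A')) (h' : Deriv Γ (B.imp B')) :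
    Deriv Γ ((A.or B).imp (A'.or B')) :=
  .or_imp (h.imp_trans (.or_left A' B')) (h'.imp_trans (.or_right A' B'))

theorem imp_mono {A A' B B' : Fml} (h : Deriv Γ (A'.imp A)) (h' : Deriv Γ (B.imp B')) :
    Deriv Γ ((A.imp B).imp (A'.imp B')) :=
  .curry ((Deriv.imp_trans (and_mono (.imp_refl _) h) (.uncurry (.imp_refl _))).imp_trans h')

instance : HeytingAlgebra (Lindenbaum Γ) where
  le := Quotient.lift₂ (fun A B => Deriv Γ (A.imp B)) fun _ _ _ _ h h' =>
    propext ⟨fun d => (h.2.imp_trans d).imp_trans h'.1, fun d => (h.1.imp_trans d).imp_trans h'.2⟩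
  le_refl := by rintro ⟨A⟩; exact .imp_refl A
  le_trans := by rintro ⟨A⟩ ⟨B⟩ ⟨C⟩ h h'; exact Deriv.imp_trans h h'
  le_antisymm := by rintro ⟨A⟩ ⟨B⟩ h h'; exact Quotient.sound ⟨h, h'⟩
  inf := Quotient.map₂ Fml.and fun _ _ h _ _ h' => ⟨and_mono h.1 h'.1, and_mono h.2 h'.2⟩
  sup := Quotient.map₂ Fml.or fun _ _ h _ _ h' => ⟨or_mono h.1 h'.1, or_mono h.2 h'.2⟩
  himp := Quotient.map₂ Fml.imp fun _ _ h _ _ h' => ⟨imp_mono h.2 h'.1, imp_mono h.1 h'.2⟩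
  compl := Quotient.map Fml.neg fun _ _ h =>
    ⟨imp_mono h.2 (.imp_refl bot), imp_mono h.1 (.imp_refl bot)⟩
  top := mk Γ (bot.imp bot)
  bot := mk Γ bot
  le_top := by rintro ⟨A⟩; exact .weaken A (.imp_refl bot)
  bot_le := by rintro ⟨A⟩; exact .bot_imp A
  inf_le_left := by rintro ⟨A⟩ ⟨B⟩; exact .and_left A B
  inf_le_right := by rintro ⟨A⟩ ⟨B⟩; exact .and_right A B
  le_inf := by rintro ⟨A⟩ ⟨B⟩ ⟨C⟩ h h'; exact Deriv.imp_and h h'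
  le_sup_left := by rintro ⟨A⟩ ⟨B⟩; exact .or_left A B
  le_sup_right := by rintro ⟨A⟩ ⟨B⟩; exact .or_right A B
  sup_le := by rintro ⟨A⟩ ⟨B⟩ ⟨C⟩ h h'; exact Deriv.or_imp h h'
  le_himp_iff := by rintro ⟨A⟩ ⟨B⟩ ⟨C⟩; exact ⟨Deriv.uncurry, Deriv.curry⟩
  himp_bot := by rintro ⟨A⟩; rfl

theorem mk_eq_top_iff (A : Fml) : mk Γ A = ⊤ ↔ Deriv Γ A := by
  rw [← top_le_iff]
  exact ⟨fun h => .mp h (.imp_refl bot), fun h => .weaken _ h⟩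

theorem eval_mk (σ : ℕ → Fml) (A : Fml) :
    eval (fun n => mk Γ (σ n)) A = mk Γ (A.subst σ) := by
  induction A with
  | var n => rfl
  | bot => rfl
  | and A B hA hB => rw [eval, hA, hB]; rfl
  | or A B hA hB => rw [eval, hA, hB]; rfl
  | imp A B hA hB => rw [eval, hA, hB]; rfl

end Lindenbaum

theorem subst_var (A : Fml) : A.subst var = A := by
  induction A <;> simp_all [Fml.subst]

/-- Algebraic completeness. -/
theorem deriv_of_forall_eval_eq_top {Γ : Set Fml} {A : Fml}
    (h : ∀ (H : Type) [HeytingAlgebra H],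
      (∀ B ∈ Γ, ∀ v : ℕ → H, eval v B = ⊤) → ∀ v : ℕ → H, eval v A = ⊤) :
    Deriv Γ A := by
  rw [← Lindenbaum.mk_eq_top_iff, ← subst_var A, ← Lindenbaum.eval_mk]
  refine h _ (fun B hB v => ?_) _
  obtain ⟨σ, rfl⟩ : ∃ σ : ℕ → Fml, v = fun n => Lindenbaum.mk Γ (σ n) := by
    choose σ hσ using fun n => Quotient.exists_rep (v n)
    exact ⟨σ, funext fun n => (hσ n).symm⟩
  rw [Lindenbaum.eval_mk, Lindenbaum.mk_eq_top_iff]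
  exact .subst σ (.extra hB)

end Semantics

section Heyting

variable {H : Type*} [HeytingAlgebra H]

theorem inf_himp_congr {c u u' w w' : H} (hu : c ⊓ u = c ⊓ u') (hw : c ⊓ w = c ⊓ w') :
    c ⊓ u ⇨ w = c ⊓ u' ⇨ w' := by
  rw [← hu]
  have key : ∀ x y : H, c ⊓ x = c ⊓ y → c ⊓ u ⇨ x ≤ c ⊓ u ⇨ y := fun x y h => by
    refine le_himp_iff.2 ?_
    have h1 : (c ⊓ u ⇨ x) ⊓ (c ⊓ u) ≤ c ⊓ x :=
      le_inf (inf_le_right.trans inf_le_left) himp_inf_le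
    exact (h1.trans h.le).trans inf_le_right
  exact le_antisymm (key _ _ hw) (key _ _ hw.symm)

theorem inf_sup_himp {c u x w : H} (hx : x ≤ w) : c ⊓ (x ⊔ u) ⇨ w = c ⊓ u ⇨ w := by
  have h : c ⊓ x ⇨ w = ⊤ := himp_eq_top_iff.2 (inf_le_right.trans hx)
  rw [inf_sup_left, sup_himp_distrib, h, top_inf_eq]

theorem inf_sup_congr {c x y y' : H} (h : c ⊓ y = c ⊓ y') : c ⊓ (x ⊔ y) = c ⊓ (x ⊔ y') := by
  rw [inf_sup_left, h, ← inf_sup_left]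

theorem inf_himp_inf_himp_sup (c d x y : H) :
    c ⊓ ((c ⇨ x) ⊓ (d ⇨ c ⊔ y)) = c ⊓ x := by
  have h : c ≤ d ⇨ c ⊔ y := le_himp_iff.2 (inf_le_left.trans le_sup_left)
  rw [inf_left_comm, inf_eq_left.2 h, himp_inf_self, inf_comm]

variable {v : ℕ → H} {x y : Fml} {c₁ c₂ : H} {a b : ℕ → H}

/-- If `p` and `q` are interpreted, below `c₂`, as `c₁ ∨ a₁ ∨ b₀` and `c₁ ∨ a₀ ∨ b₁`, then the
key formulas `F_k`, `G_k` continue the sequences `a`, `b`. -/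
theorem eval_FG (hx : eval v x = c₁) (hy : eval v y = c₂)
    (hp : c₂ ⊓ v 0 = c₂ ⊓ (c₁ ⊔ (a 1 ⊔ b 0))) (hq : c₂ ⊓ v 1 = c₂ ⊓ (c₁ ⊔ (a 0 ⊔ b 1)))
    (ha : Monotone a) (hb : Monotone b)
    (hasucc : ∀ n, a (n + 2) = c₂ ⊓ b (n + 1) ⇨ c₁ ⊔ (a (n + 1) ⊔ b n))
    (hbsucc : ∀ n, b (n + 2) = c₂ ⊓ a (n + 1) ⇨ c₁ ⊔ (a n ⊔ b (n + 1))) (k : ℕ) :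
    eval v (FG x y (k + 1)).1 = a (k + 2) ∧ eval v (FG x y (k + 1)).2 = b (k + 2) := by
  induction k using Nat.strong_induction_on with
  | _ k ih =>
  match k with
  | 0 =>
    simp only [FG, eval, Fml.p, Fml.q, hx, hy]
    constructor
    · rw [inf_himp_congr hq (inf_sup_congr hp), ← sup_assoc c₁ c₁, sup_idem, ← sup_assoc c₁ (a 0),
        inf_sup_himp, hasucc]
      exact sup_le_sup_left (le_sup_of_le_left (ha (by simp))) _
    · rw [inf_himp_congr hp (inf_sup_congr hq), ← sup_assoc c₁ c₁, sup_idem, sup_comm (a 1),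
        ← sup_assoc c₁ (b 0), inf_sup_himp, hbsucc]
      exact sup_le_sup_left (le_sup_of_le_right (hb (by simp))) _
  | 1 =>
    obtain ⟨h1, h2⟩ := ih 0 (by simp)
    simp only [zero_add] at h1 h2
    simp only [FG.eq_3, eval, hx, hy, h1, h2, FG.eq_1, Fml.p, Fml.q]
    constructor
    · rw [inf_himp_congr rfl (inf_sup_congr (inf_sup_congr hq)), hasucc 1]
      have h : a 0 ≤ a 2 := ha (by simp)
      rw [sup_left_comm (a 2), ← sup_assoc c₁ c₁, sup_idem, ← sup_assoc (a 2), sup_eq_left.2 h]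
    · rw [inf_himp_congr rfl (inf_sup_congr (inf_sup_congr hp)), hbsucc 1]
      have h : b 0 ≤ b 2 := hb (by simp)
      rw [sup_left_comm (b 2), ← sup_assoc c₁ c₁, sup_idem, sup_comm (a 1), ← sup_assoc (b 2),
        sup_eq_left.2 h, sup_comm (a 1)]
  | k + 2 =>
    obtain ⟨h1, h2⟩ := ih (k + 1) (by simp)
    obtain ⟨h3, h4⟩ := ih k (by simp)
    rw [FG]
    simp only [eval, hx, hy, h1, h2, h3, h4]
    exact ⟨(hasucc (k + 2)).symm, by rw [sup_comm (b _), hbsucc (k + 2)]⟩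

theorem eval_ST_congr {v v' : ℕ → H} {x : Fml} (h : eval v x = eval v' x) (n : ℕ) :
    eval v (ST x n).1 = eval v' (ST x n).1 ∧ eval v (ST x n).2 = eval v' (ST x n).2 := by
  induction n using Nat.strong_induction_on with
  | _ n ih =>
  match n with
  | 0 => simp only [ST, Fml.neg, eval, h, and_self]
  | 1 => simp only [ST, Fml.neg, eval, h, and_self]
  | n + 2 =>
    obtain ⟨h1, h2⟩ := ih (n + 1) (by simp)
    obtain ⟨h3, h4⟩ := ih n (by simp)
    simp only [ST, eval, h1, h2, h4, and_self]

theorem eval_AB_congr {v v' : ℕ → H} {x c₁ c₂ : Fml} (h : eval v x = eval v' x)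
    (hc₁ : eval v c₁ = eval v' c₁) (hc₂ : eval v c₂ = eval v' c₂) (n : ℕ) :
    eval v (AB x c₁ c₂ n).1 = eval v' (AB x c₁ c₂ n).1 ∧
      eval v (AB x c₁ c₂ n).2 = eval v' (AB x c₁ c₂ n).2 := by
  have hS : ∀ n, eval v (Sf x n) = eval v' (Sf x n) := fun n => (eval_ST_congr h n).1
  have hT : ∀ n, eval v (Tf x n) = eval v' (Tf x n) := fun n => (eval_ST_congr h n).2
  induction n using Nat.strong_induction_on with
  | _ n ih =>
  match n with
  | 0 | 1 | 2 | 3 | 4 => simp only [AB, eval, hS, hT, hc₁, and_self]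
  | n + 5 =>
    obtain ⟨h1, h2⟩ := ih (n + 4) (by simp)
    obtain ⟨h3, h4⟩ := ih (n + 3) (by simp)
    simp only [AB.eq_6, eval, h1, h2, h3, h4, hc₁, hc₂, and_self]

theorem eval_A0_congr {v v' : ℕ → H} (h : v 2 = v' 2) (n : ℕ) :
    eval v (A0 n) = eval v' (A0 n) :=
  (eval_ST_congr (x := r) h n).1

theorem eval_B0_congr {v v' : ℕ → H} (h : v 2 = v' 2) (n : ℕ) :
    eval v (B0 n) = eval v' (B0 n) :=
  (eval_ST_congr (x := r) h n).2

theorem eval_A1_congr {v v' : ℕ → H} (h : v 2 = v' 2) (hp : v 0 = v' 0) (n : ℕ) :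
    eval v (A1 n) = eval v' (A1 n) :=
  (eval_AB_congr (x := p) hp (eval_A0_congr h 5) (eval_B0_congr h 5) n).1

theorem eval_B1_congr {v v' : ℕ → H} (h : v 2 = v' 2) (hp : v 0 = v' 0) (n : ℕ) :
    eval v (B1 n) = eval v' (B1 n) :=
  (eval_AB_congr (x := p) hp (eval_A0_congr h 5) (eval_B0_congr h 5) n).2

theorem eval_A2_congr {v v' : ℕ → H} (h : v 2 = v' 2) (hq : v 1 = v' 1) (n : ℕ) :
    eval v (A2 n) = eval v' (A2 n) :=
  (eval_AB_congr (x := q) hq (eval_B0_congr h 5) (eval_A0_congr h 5) n).1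

theorem eval_B2_congr {v v' : ℕ → H} (h : v 2 = v' 2) (hq : v 1 = v' 1) (n : ℕ) :
    eval v (B2 n) = eval v' (B2 n) :=
  (eval_AB_congr (x := q) hq (eval_B0_congr h 5) (eval_A0_congr h 5) n).2

theorem eval_AB_fst_monotone (v : ℕ → H) (x c₁ c₂ : Fml) :
    Monotone fun n => eval v (AB x c₁ c₂ (n + 3)).1 := by
  refine monotone_nat_of_le_succ fun n => ?_
  cases n with
  | zero => exact le_himp_iff.2 (inf_le_left.trans le_sup_left)
  | succ n => exact le_himp_iff.2 (inf_le_left.trans (le_sup_left.trans le_sup_right))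

theorem eval_AB_snd_monotone (v : ℕ → H) (x c₁ c₂ : Fml) :
    Monotone fun n => eval v (AB x c₁ c₂ (n + 3)).2 := by
  refine monotone_nat_of_le_succ fun n => ?_
  cases n with
  | zero => exact le_himp_iff.2 (inf_le_left.trans le_sup_right)
  | succ n => exact le_himp_iff.2 (inf_le_left.trans (le_sup_right.trans le_sup_right))

/-- The key formulas evaluate to the formulas of the group `AB`, starting at index `i + 5`. -/
theorem eval_FG_eq_eval_AB {v v' : ℕ → H} {z c₁ c₂ : Fml} (i : ℕ)
    (hc₁ : eval v' c₁ = eval v c₁) (hc₂ : eval v' c₂ = eval v c₂)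
    (hp : eval v c₂ ⊓ v' 0 = eval v c₂ ⊓
      eval v (c₁.or ((AB z c₁ c₂ (i + 4)).1.or (AB z c₁ c₂ (i + 3)).2)))
    (hq : eval v c₂ ⊓ v' 1 = eval v c₂ ⊓
      eval v (c₁.or ((AB z c₁ c₂ (i + 3)).1.or (AB z c₁ c₂ (i + 4)).2))) (k : ℕ) :
    eval v' (FG c₁ c₂ (k + 1)).1 = eval v (AB z c₁ c₂ (i + k + 5)).1 ∧
      eval v' (FG c₁ c₂ (k + 1)).2 = eval v (AB z c₁ c₂ (i + k + 5)).2 := by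
  have hshift : Monotone fun n : ℕ => i + n := fun _ _ h => Nat.add_le_add_left h i
  exact eval_FG (a := fun n => eval v (AB z c₁ c₂ (i + n + 3)).1)
    (b := fun n => eval v (AB z c₁ c₂ (i + n + 3)).2) hc₁ hc₂ hp hq
    ((eval_AB_fst_monotone v z c₁ c₂).comp hshift) ((eval_AB_snd_monotone v z c₁ c₂).comp hshift)
    (fun _ => rfl) (fun _ => rfl) k

/-- The valuation interpreting `p`, `q` as `P`, `Q`. -/
def shiftVal (v : ℕ → H) (i j : ℕ) : ℕ → H
  | 0 => eval v (Pf i j)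
  | 1 => eval v (Qf i j)
  | n => v n

theorem eval_Ehat (v : ℕ → H) (s i j k l : ℕ) :
    eval (shiftVal v i j) (Ehat s (k + 1) (l + 1)) = eval v (Efml s (i + k) (j + l)) := by
  have h2 : shiftVal v i j 2 = v 2 := rfl
  have hC1 : eval (shiftVal v i j) C1 = eval v C1 := eval_A0_congr h2 5
  have hC2 : eval (shiftVal v i j) C2 = eval v C2 := eval_B0_congr h2 5
  have h1 := eval_FG_eq_eval_AB (z := p) i hC1 hC2
    (inf_himp_inf_himp_sup _ _ _ _) (inf_himp_inf_himp_sup _ _ _ _)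
  have h2' := eval_FG_eq_eval_AB (z := q) j hC2 hC1
    ((congrArg _ (inf_comm _ _)).trans (inf_himp_inf_himp_sup _ _ _ _))
    ((congrArg _ (inf_comm _ _)).trans (inf_himp_inf_himp_sup _ _ _ _))
  simp only [Ehat, Efml, eval, eval_A0_congr h2, eval_B0_congr h2, F1k, G1k, F2k, G2k,
    (h1 _).1, (h1 _).2, (h2' _).1, (h2' _).2]
  rfl

theorem inf_himp_le_inf_himp {K L K' L' : H} (h : K ⇨ L ≤ K' ⇨ L') (e : H) :
    K ⊓ e ⇨ L ≤ K' ⊓ e ⇨ L' := by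
  rw [inf_comm K, inf_comm K', ← himp_himp, ← himp_himp]
  exact himp_le_himp_left h

theorem eval_Efml_le_of_Ehat0star {s u : ℕ}
    (h : ∀ v : ℕ → H, eval v (Ehat0star u) ≤ eval v (Ehat0star s)) (v : ℕ → H) (n : ℕ) :
    eval v (Efml u 0 n) ≤ eval v (Efml s 0 n) := by
  obtain ⟨v', hq, h0, h2⟩ : ∃ v' : ℕ → H,
      v' 1 = eval v ((A2 (n + 5)).or (B2 (n + 5))) ∧ v' 0 = v 0 ∧ v' 2 = v 2 :=
    ⟨Function.update v 1 (eval v ((A2 (n + 5)).or (B2 (n + 5)))), by simp⟩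
  have := inf_himp_le_inf_himp (h v') (eval v (A2 (n + 6)) ⊓ eval v (B2 (n + 6)))
  simpa only [Efml, eval, eval_A0_congr h2, eval_B0_congr h2, eval_A1_congr h2 h0,
    eval_B1_congr h2 h0, Fml.q, hq, zero_add, inf_assoc] using this

theorem eval_Efml_le_of_Ehatstar0 {s u : ℕ}
    (h : ∀ v : ℕ → H, eval v (Ehatstar0 u) ≤ eval v (Ehatstar0 s)) (v : ℕ → H) (m : ℕ) :
    eval v (Efml u m 0) ≤ eval v (Efml s m 0) := by
  obtain ⟨v', hp, h1, h2⟩ : ∃ v' : ℕ → H,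
      v' 0 = eval v ((A1 (m + 5)).or (B1 (m + 5))) ∧ v' 1 = v 1 ∧ v' 2 = v 2 :=
    ⟨Function.update v 0 (eval v ((A1 (m + 5)).or (B1 (m + 5)))), by simp⟩
  have := inf_himp_le_inf_himp (h v') (eval v (A1 (m + 6)) ⊓ eval v (B1 (m + 6)))
  have comm (a b c d e f : H) :
      (a ⊓ (b ⊓ (c ⊓ d))) ⊓ (e ⊓ f) = a ⊓ (b ⊓ (e ⊓ (f ⊓ (c ⊓ d)))) := by
    rw [inf_assoc a, inf_assoc b, inf_comm (c ⊓ d), inf_assoc e]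
  simpa only [Efml, eval, eval_A0_congr h2, eval_B0_congr h2, eval_A2_congr h2 h1,
    eval_B2_congr h2 h1, Fml.p, hp, zero_add, sup_assoc, comm] using this

theorem eval_AxI_eq_top {M : Minsky} {I : MInstr} (hI : I ∈ M.instrs) {v : ℕ → H}
    (h : eval v (AxM M) = ⊤) : eval v (AxI I) = ⊤ := by
  unfold AxM at h
  generalize M.instrs = L at h hI
  induction L with
  | nil => simp at hI
  | cons J L ih =>
    simp only [List.foldr_cons, eval, inf_eq_top_iff] at h
    rcases List.mem_cons.1 hI with rfl | hI
    · exact h.1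
    · exact ih h.2 hI

end Heyting

end Paper

open Paper in
/-- if (s,m,n) is transformed into (t,k,l) by a single application
    of one instruction of 𝓜, then Int + Ax(𝓜) ⊢ E_{t,k,l} → E_{s,m,n}. -/
theorem statement10 (M : Minsky) (s m n t k l : ℕ)
    (h : M.Step (s, m, n) (t, k, l)) :
    Deriv {AxM M} ((Efml t k l).imp (Efml s m n)) := by
  refine deriv_of_forall_eval_eq_top fun H _ hM v => ?_
  obtain ⟨I, hI, hstep⟩ := h
  have hAx : ∀ v : ℕ → H, eval v (AxI I) = ⊤ := fun v => eval_AxI_eq_top hI (hM _ rfl v)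
  refine himp_eq_top_iff.2 ?_
  cases I with
  | inc1 s' t' =>
    obtain ⟨m', n', h1, h2⟩ := hstep
    cases h1; cases h2
    have := himp_eq_top_iff.1 (hAx (shiftVal v m n))
    rwa [eval_Ehat v t m n 1 0, eval_Ehat v s m n 0 0] at this
  | inc2 s' t' =>
    obtain ⟨m', n', h1, h2⟩ := hstep
    cases h1; cases h2
    have := himp_eq_top_iff.1 (hAx (shiftVal v m n))
    rwa [eval_Ehat v t m n 0 1, eval_Ehat v s m n 0 0] at this
  | dec1 s' t' u' =>
    obtain ⟨m', n', h1, ⟨hm, h2⟩ | ⟨rfl, h2⟩⟩ := hstep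
    · cases h1; cases h2
      obtain ⟨m, rfl⟩ := Nat.exists_eq_succ_of_ne_zero hm.ne'
      have := himp_eq_top_iff.1 (inf_eq_top_iff.1 (hAx (shiftVal v m n))).1
      rwa [eval_Ehat v t m n 0 0, eval_Ehat v s m n 1 0] at this
    · cases h1; cases h2
      exact eval_Efml_le_of_Ehat0star
        (fun v => himp_eq_top_iff.1 (inf_eq_top_iff.1 (hAx v)).2) v n
  | dec2 s' t' u' =>
    obtain ⟨m', n', h1, ⟨hn, h2⟩ | ⟨rfl, h2⟩⟩ := hstep
    · cases h1; cases h2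
      obtain ⟨n, rfl⟩ := Nat.exists_eq_succ_of_ne_zero hn.ne'
      have := himp_eq_top_iff.1 (inf_eq_top_iff.1 (hAx (shiftVal v m n))).1
      rwa [eval_Ehat v t m n 0 0, eval_Ehat v s m n 0 1] at this
    · cases h1; cases h2
      exact eval_Efml_le_of_Ehatstar0
        (fun v => himp_eq_top_iff.1 (inf_eq_top_iff.1 (hAx v)).2) v m
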